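/- arXiv:1405.0995 — 4 statements merged into one kernel-verified Lean document; each statement's English description precedes it below -/
import Mathlib

section
/- Let d ∈ {1,2} and let p be a real number with 2 ≤ p < ∞; set δ = d(1/2 − 1/p) and let p' = p/(p − 1) be the conjugate exponent. Then there exists a constant C > 0 such that for every measurable function f : ℝ^d → ℂ with ‖f‖_{L²(ℝ^d)} < ∞ and ‖ |x| f ‖_{L²(ℝ^d)} < ∞, one has ‖f‖_{L^{p'}(ℝ^d)} ≤ C ‖f‖_{L²(ℝ^d)}^{1−δ} ‖ |x| f ‖_{L²(ℝ^d)}^{δ}. -/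
open MeasureTheory

section WeightedHolder

variable {E : Type*} [NormedAddCommGroup E] [NormedSpace ℝ E] [FiniteDimensional ℝ E]
  [MeasurableSpace E] [BorelSpace E] (μ : Measure E) [μ.IsAddHaarMeasure]

theorem eLpNorm_inv_one_add_norm_lt_top {s : ℝ} (hs : (Module.finrank ℝ E : ℝ) < s) :
    eLpNorm (fun x : E => (1 + ‖x‖)⁻¹) (ENNReal.ofReal s) μ < ⊤ := by
  have hs0 : 0 < s := (Nat.cast_nonneg _).trans_lt hs
  rw [eLpNorm_lt_top_iff_lintegral_rpow_enorm_lt_top (by simpa using hs0) ENNReal.ofReal_ne_top,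
    ENNReal.toReal_ofReal hs0.le]
  convert finite_integral_one_add_norm (μ := μ) hs using 3 with x
  have hx : 0 < 1 + ‖x‖ := by positivity
  rw [Real.enorm_of_nonneg (by positivity), ENNReal.ofReal_rpow_of_nonneg (by positivity) hs0.le,
    Real.rpow_neg hx.le, Real.inv_rpow hx.le]

theorem eLpNorm_comp_smul_eq {F : Type*} [NormedAddCommGroup F] {g : E → F}
    (hg : StronglyMeasurable g) {s c : ℝ} (hs : 0 < s) (hc : 0 < c) :
    eLpNorm (fun x => g (c • x)) (ENNReal.ofReal s) μ =
      ENNReal.ofReal (c ^ (-(Module.finrank ℝ E / s))) * eLpNorm g (ENNReal.ofReal s) μ := by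
  have h := eLpNorm_map_measure (p := ENNReal.ofReal s) (μ := μ) (f := fun x : E => c • x)
    hg.aestronglyMeasurable (by fun_prop)
  rw [Measure.map_addHaar_smul μ hc.ne',
    eLpNorm_smul_measure_of_ne_top ENNReal.ofReal_ne_top] at h
  rw [← Function.comp_def g, ← h, smul_eq_mul, one_div, ENNReal.toReal_inv,
    ENNReal.toReal_ofReal hs.le, abs_of_pos (by positivity),
    ENNReal.ofReal_rpow_of_nonneg (by positivity) (by positivity),
    Real.inv_rpow (by positivity), ← Real.rpow_natCast, ← Real.rpow_mul hc.le,
    Real.rpow_neg hc.le, div_eq_mul_inv]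

theorem eLpNorm_le_weighted {F : Type*} [NormedAddCommGroup F] [NormedSpace ℝ F] {s c : ℝ}
    (hs : 0 < s) (hc : 0 < c) {q : ENNReal} [ENNReal.HolderTriple (ENNReal.ofReal s) 2 q]
    {f : E → F} (hf : AEStronglyMeasurable f μ) :
    eLpNorm f q μ ≤ ENNReal.ofReal (c ^ (-(Module.finrank ℝ E / s))) *
      eLpNorm (fun x : E => (1 + ‖x‖)⁻¹) (ENNReal.ofReal s) μ *
        (eLpNorm f 2 μ + ENNReal.ofReal c * eLpNorm (fun x => ‖x‖ • f x) 2 μ) := by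
  have hsm : StronglyMeasurable fun x : E => (1 + ‖x‖)⁻¹ :=
    Measurable.stronglyMeasurable (by fun_prop)
  have hfm : AEStronglyMeasurable (fun x => ‖x‖ • f x) μ :=
    continuous_norm.aestronglyMeasurable.smul hf
  have hfactor : f = (fun x : E => (1 + ‖c • x‖)⁻¹) • (f + c • fun x => ‖x‖ • f x) := by
    ext x
    have hx : 1 + ‖c • x‖ ≠ 0 := by positivity
    simp only [Pi.smul_apply', Pi.add_apply, Pi.smul_apply]
    rw [eq_inv_smul_iff₀ hx, norm_smul, Real.norm_of_nonneg hc.le, add_smul, one_smul, mul_smul]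
  calc eLpNorm f q μ
      = eLpNorm ((fun x : E => (1 + ‖c • x‖)⁻¹) • (f + c • fun x => ‖x‖ • f x)) q μ := by
        rw [← hfactor]
    _ ≤ eLpNorm (fun x : E => (1 + ‖c • x‖)⁻¹) (ENNReal.ofReal s) μ *
          eLpNorm (f + c • fun x => ‖x‖ • f x) 2 μ :=
        eLpNorm_smul_le_mul_eLpNorm (hf.add (hfm.const_smul c))
          (hsm.comp_measurable (measurable_const_smul c)).aestronglyMeasurable
    _ ≤ _ := by
        rw [eLpNorm_comp_smul_eq μ hsm hs hc]
        gcongr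
        refine (eLpNorm_add_le hf (hfm.const_smul c) (by norm_num)).trans ?_
        rw [eLpNorm_const_smul, Real.enorm_of_nonneg hc.le]

theorem eLpNorm_toReal_le_interpolation {F : Type*} [NormedAddCommGroup F] [NormedSpace ℝ F]
    {s : ℝ} (hs : (Module.finrank ℝ E : ℝ) < s) {q : ENNReal}
    [ENNReal.HolderTriple (ENNReal.ofReal s) 2 q] [Nontrivial E] {f : E → F}
    (hf : AEStronglyMeasurable f μ) (h₂ : eLpNorm f 2 μ < ⊤)
    (hx : eLpNorm (fun x => ‖x‖ • f x) 2 μ < ⊤) :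
    (eLpNorm f q μ).toReal ≤
      2 * (eLpNorm (fun x : E => (1 + ‖x‖)⁻¹) (ENNReal.ofReal s) μ).toReal *
        (eLpNorm f 2 μ).toReal ^ (1 - Module.finrank ℝ E / s) *
        (eLpNorm (fun x => ‖x‖ • f x) 2 μ).toReal ^ (Module.finrank ℝ E / s) := by
  have hs0 : 0 < s := (Nat.cast_nonneg _).trans_lt hs
  have hfm : AEStronglyMeasurable (fun x => ‖x‖ • f x) μ :=
    continuous_norm.aestronglyMeasurable.smul hf
  by_cases hf0 : f =ᵐ[μ] 0
  · rw [eLpNorm_congr_ae hf0, eLpNorm_zero, ENNReal.toReal_zero]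
    positivity
  have hA : 0 < (eLpNorm f 2 μ).toReal := by
    refine ENNReal.toReal_pos (fun h => hf0 ?_) h₂.ne
    rwa [eLpNorm_eq_zero_iff hf (by norm_num)] at h
  have hB : 0 < (eLpNorm (fun x => ‖x‖ • f x) 2 μ).toReal := by
    refine ENNReal.toReal_pos (fun h => hf0 ?_) hx.ne
    rw [eLpNorm_eq_zero_iff hfm (by norm_num)] at h
    filter_upwards [h, Measure.ae_ne μ 0] with x h₁ h₀
    simpa [h₀] using h₁
  set A := (eLpNorm f 2 μ).toReal with hA_def
  set B := (eLpNorm (fun x => ‖x‖ • f x) 2 μ).toReal with hB_def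
  set K := (eLpNorm (fun x : E => (1 + ‖x‖)⁻¹) (ENNReal.ofReal s) μ).toReal with hK_def
  set δ := (Module.finrank ℝ E : ℝ) / s
  have hc : 0 < A / B := div_pos hA hB
  have hbound := ENNReal.toReal_mono (ENNReal.mul_ne_top (ENNReal.mul_ne_top ENNReal.ofReal_ne_top
    (eLpNorm_inv_one_add_norm_lt_top μ hs).ne) (ENNReal.add_ne_top.2
      ⟨h₂.ne, ENNReal.mul_ne_top ENNReal.ofReal_ne_top hx.ne⟩))
    (eLpNorm_le_weighted μ hs0 hc hf (q := q))
  rw [ENNReal.toReal_mul, ENNReal.toReal_mul, ENNReal.toReal_add h₂.ne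
    (ENNReal.mul_ne_top ENNReal.ofReal_ne_top hx.ne), ENNReal.toReal_mul,
    ENNReal.toReal_ofReal (by positivity), ENNReal.toReal_ofReal hc.le, ← hA_def, ← hB_def,
    ← hK_def, div_mul_cancel₀ _ hB.ne'] at hbound
  refine hbound.trans_eq ?_
  rw [Real.rpow_neg hc.le, Real.div_rpow hA.le hB.le, Real.rpow_sub hA, Real.rpow_one]
  field_simp
  ring

end WeightedHolder

/-- Dual Gagliardo–Nirenberg inequality on `ℝ^d`, `d ∈ {1,2}`, `2 ≤ p < ∞`,
`p'` the conjugate exponent, `δ = d(1/2 − 1/p)`: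
`‖f‖_{L^{p'}} ≤ C ‖f‖_{L²}^{1−δ} ‖|x| f‖_{L²}^δ`. -/
theorem dual_gagliardo_nirenberg (d : ℕ) (hd : d = 1 ∨ d = 2) (p δ p' : ℝ) (hp : 2 ≤ p)
    (hδ : δ = d * (1 / 2 - 1 / p)) (hp' : p' = p / (p - 1)) :
    ∃ C > 0, ∀ f : EuclideanSpace ℝ (Fin d) → ℂ, Measurable f →
      eLpNorm f 2 volume < ⊤ →
      eLpNorm (fun x => ‖x‖ • f x) 2 volume < ⊤ →
      (eLpNorm f (ENNReal.ofReal p') volume).toReal ≤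
        C * (eLpNorm f 2 volume).toReal ^ (1 - δ) *
          (eLpNorm (fun x => ‖x‖ • f x) 2 volume).toReal ^ δ := by
  rcases hp.eq_or_lt with rfl | hp
  · refine ⟨1, one_pos, fun f _ _ _ => ?_⟩
    norm_num [hδ, hp']
  have hd2 : (d : ℝ) ≤ 2 := by rcases hd with rfl | rfl <;> norm_num
  have : NeZero d := ⟨by omega⟩
  have hp2 : 0 < p - 2 := by linarith
  have hp1 : 0 < p - 1 := by linarith
  set s : ℝ := 2 * p / (p - 2) with hs_def
  have hs : (Module.finrank ℝ (EuclideanSpace ℝ (Fin d)) : ℝ) < s := by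
    rw [finrank_euclideanSpace_fin]
    refine hd2.trans_lt ?_
    rw [hs_def, lt_div_iff₀ hp2]
    linarith
  have hs0 : 0 < s := by positivity
  have hp'0 : 0 < p' := by rw [hp']; positivity
  have htriple : s.HolderTriple 2 p' := by
    refine ⟨?_, hs0, two_pos⟩
    rw [hs_def, hp']
    field_simp
    ring
  have : ENNReal.HolderTriple (ENNReal.ofReal s) 2 (ENNReal.ofReal p') := by
    simpa using htriple.ennrealOfReal
  have hδs : δ = Module.finrank ℝ (EuclideanSpace ℝ (Fin d)) / s := by
    rw [finrank_euclideanSpace_fin, hδ, hs_def]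
    field_simp
  refine ⟨2 * (eLpNorm (fun x : EuclideanSpace ℝ (Fin d) => (1 + ‖x‖)⁻¹)
    (ENNReal.ofReal s) volume).toReal + 1, by positivity, fun f hf h₂ hx => ?_⟩
  rw [hδs]
  refine (eLpNorm_toReal_le_interpolation volume hs hf.aestronglyMeasurable h₂ hx).trans ?_
  gcongr
  linarith
end

section
/- Let d ∈ {1,2} and let α be a real number with 0 < α ≤ 1. Then there exists a constant C > 0 such that for every smooth compactly supported function f : ℝ^d → ℂ, ‖f‖_{L²(ℝ^d)}^{αd + 8 − 4α} ≤ C ‖f‖_{L^{2−α}(ℝ^d)}^{4(2−α)} ‖∇²f‖_{L²(ℝ^d)}^{αd}. -/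
open MeasureTheory

section Directional

variable {E F : Type*} [NormedAddCommGroup E] [NormedSpace ℝ E]
  [NormedAddCommGroup F] [NormedSpace ℝ F]

/-- The derivative of `f` in the direction `v`, as a function. -/
noncomputable def dirDeriv (v : E) (f : E → F) : E → F := fun x => fderiv ℝ f x v

lemma ContDiff.dirDeriv {f : E → F} (hf : ContDiff ℝ (⊤ : ℕ∞) f) (v : E) :
    ContDiff ℝ (⊤ : ℕ∞) (dirDeriv v f) :=
  (hf.fderiv_right (m := (⊤ : ℕ∞)) (by simp)).clm_apply contDiff_const

lemma HasCompactSupport.dirDeriv {f : E → F} (hf : HasCompactSupport f) (v : E) :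
    HasCompactSupport (dirDeriv v f) :=
  hf.fderiv_apply ℝ v

lemma enorm_dirDeriv_dirDeriv_le {f : E → F} (hf : ContDiff ℝ (⊤ : ℕ∞) f) {v w : E}
    (hv : ‖v‖ ≤ 1) (hw : ‖w‖ ≤ 1) (x : E) :
    ‖dirDeriv w (dirDeriv v f) x‖ₑ ≤ ‖iteratedFDeriv ℝ 2 f x‖ₑ := by
  have hd : DifferentiableAt ℝ (fderiv ℝ f) x :=
    ((hf.fderiv_right (m := (⊤ : ℕ∞)) (by simp)).differentiable (by simp)).differentiableAt
  have h : dirDeriv w (dirDeriv v f) x = iteratedFDeriv ℝ 2 f x ![w, v] := by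
    rw [iteratedFDeriv_two_apply]
    change fderiv ℝ (fun y => fderiv ℝ f y v) x w = _
    rw [fderiv_clm_apply hd (by fun_prop)]
    simp
  rw [h, enorm_le_iff_norm_le]
  refine (ContinuousMultilinearMap.le_opNorm _ _).trans ?_
  simp only [Fin.prod_univ_two, Matrix.cons_val_zero, Matrix.cons_val_one]
  exact mul_le_of_le_one_right (norm_nonneg _) (mul_le_one₀ hw (norm_nonneg _) hv)

/-- A compactly supported function is controlled by the integral of its derivative along a line. -/
lemma enorm_le_lintegral_dirDeriv {f : E → F} (hf : ContDiff ℝ (⊤ : ℕ∞) f)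
    (hc : HasCompactSupport f) (x : E) {v : E} (hv : v ≠ 0) :
    ‖f x‖ₑ ≤ ∫⁻ t : ℝ, ‖dirDeriv v f (x + t • v)‖ₑ := by
  have hemb : Topology.IsClosedEmbedding (fun t : ℝ => x + t • v) :=
    (Homeomorph.addLeft x).isClosedEmbedding.comp (isClosedEmbedding_smul_left hv)
  have hg : ContDiff ℝ 1 (f ∘ fun t : ℝ => x + t • v) :=
    (hf.of_le (by exact_mod_cast le_top)).comp (by fun_prop)
  have h := (hc.comp_isClosedEmbedding hemb).enorm_le_lintegral_Ici_deriv hg 0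
  have hd (t : ℝ) : deriv (f ∘ fun t : ℝ => x + t • v) t = dirDeriv v f (x + t • v) := by
    have h1 : HasDerivAt (fun t : ℝ => x + t • v) v t := by
      simpa using ((hasDerivAt_id t).smul_const v).const_add x
    exact ((hf.differentiable (by simp)).differentiableAt.hasFDerivAt.comp_hasDerivAt t h1).deriv
  simp only [hd, Function.comp_apply, zero_smul, add_zero] at h
  exact h.trans (setLIntegral_le_lintegral _ _)

end Directional

lemma lintegral_enorm_mul_enorm_le {X F G : Type*} [MeasurableSpace X] {μ : Measure X}
    [NormedAddCommGroup F] [NormedAddCommGroup G] {f : X → F} {g : X → G}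
    (hf : AEStronglyMeasurable f μ) (hg : AEStronglyMeasurable g μ) :
    ∫⁻ x, ‖f x‖ₑ * ‖g x‖ₑ ∂μ ≤ eLpNorm f 2 μ * eLpNorm g 2 μ := by
  have h := ENNReal.lintegral_mul_le_Lp_mul_Lq μ Real.HolderConjugate.two_two hf.enorm hg.enorm
  simpa [eLpNorm_eq_lintegral_rpow_enorm_toReal] using h

lemma eLpNorm_two_sq {X F : Type*} [MeasurableSpace X] {μ : Measure X}
    [NormedAddCommGroup F] (f : X → F) :
    eLpNorm f 2 μ ^ 2 = ∫⁻ x, ‖f x‖ₑ ^ 2 ∂μ := by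
  simpa using eLpNorm_nnreal_pow_eq_lintegral (μ := μ) (f := f) (p := 2) (by simp)

lemma eLpNorm_dirDeriv_dirDeriv_le {E F : Type*} [NormedAddCommGroup E] [NormedSpace ℝ E]
    [MeasurableSpace E] {μ : Measure E} [NormedAddCommGroup F] [NormedSpace ℝ F] {f : E → F}
    (hf : ContDiff ℝ (⊤ : ℕ∞) f) {v w : E} (hv : ‖v‖ ≤ 1) (hw : ‖w‖ ≤ 1) :
    eLpNorm (dirDeriv w (dirDeriv v f)) 2 μ ≤
      eLpNorm (fun x => ‖iteratedFDeriv ℝ 2 f x‖) 2 μ :=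
  eLpNorm_mono_enorm fun x => by simpa using enorm_dirDeriv_dirDeriv_le hf hv hw x

section Interpolation

variable {E F : Type*} [NormedAddCommGroup E] [NormedSpace ℝ E] [FiniteDimensional ℝ E]
  [MeasurableSpace E] [BorelSpace E] {μ : Measure E} [μ.IsAddHaarMeasure]
  [NormedAddCommGroup F] [InnerProductSpace ℝ F]

lemma eLpNorm_dirDeriv_sq_le {f : E → F} (hf : ContDiff ℝ (⊤ : ℕ∞) f)
    (hc : HasCompactSupport f) (v : E) :
    eLpNorm (dirDeriv v f) 2 μ ^ 2 ≤
      eLpNorm f 2 μ * eLpNorm (dirDeriv v (dirDeriv v f)) 2 μ := by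
  have hf1 := hf.dirDeriv v
  have hf2 := hf1.dirDeriv v
  have hc1 := hc.dirDeriv v
  have hint {g h : E → F} (hg : Continuous g) (hh : Continuous h) (hgc : HasCompactSupport g) :
      Integrable (fun x => inner ℝ (g x) (h x)) μ :=
    (hg.inner hh).integrable_of_hasCompactSupport
      (hgc.mono fun x hx h0 => hx (by simp [h0]))
  have hparts : ∫ x, inner ℝ (f x) (dirDeriv v (dirDeriv v f) x) ∂μ =
      -∫ x, inner ℝ (dirDeriv v f x) (dirDeriv v f x) ∂μ :=
    integral_bilinear_fderiv_right_eq_neg_left_of_integrable (B := innerSL ℝ)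
      (f := f) (g := dirDeriv v f) (v := v)
      (hint hf1.continuous hf1.continuous hc1) (hint hf.continuous hf2.continuous hc)
      (hint hf.continuous hf1.continuous hc)
      (fun x _ => (hf.differentiable (by simp)).differentiableAt)
      (fun x _ => (hf1.differentiable (by simp)).differentiableAt)
  calc eLpNorm (dirDeriv v f) 2 μ ^ 2
      = ∫⁻ x, ENNReal.ofReal (inner ℝ (dirDeriv v f x) (dirDeriv v f x)) ∂μ := by
        rw [eLpNorm_two_sq]
        refine lintegral_congr fun x => ?_
        rw [real_inner_self_eq_norm_sq, ENNReal.ofReal_pow (norm_nonneg _), ofReal_norm]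
    _ = ENNReal.ofReal (∫ x, inner ℝ (dirDeriv v f x) (dirDeriv v f x) ∂μ) :=
        (ofReal_integral_eq_lintegral_ofReal (hint hf1.continuous hf1.continuous hc1)
          (Filter.Eventually.of_forall fun x => real_inner_self_nonneg)).symm
    _ = ENNReal.ofReal (-∫ x, inner ℝ (f x) (dirDeriv v (dirDeriv v f) x) ∂μ) := by
        rw [hparts, neg_neg]
    _ ≤ ‖∫ x, inner ℝ (f x) (dirDeriv v (dirDeriv v f) x) ∂μ‖ₑ := by
        rw [← ofReal_norm]
        exact ENNReal.ofReal_le_ofReal (neg_le_abs _)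
    _ ≤ ∫⁻ x, ‖inner ℝ (f x) (dirDeriv v (dirDeriv v f) x)‖ₑ ∂μ :=
        enorm_integral_le_lintegral_enorm _
    _ ≤ ∫⁻ x, ‖f x‖ₑ * ‖dirDeriv v (dirDeriv v f) x‖ₑ ∂μ := by
        refine lintegral_mono fun x => ?_
        rw [← ofReal_norm, ← ofReal_norm, ← ofReal_norm, ← ENNReal.ofReal_mul (norm_nonneg _)]
        exact ENNReal.ofReal_le_ofReal (norm_inner_le_norm _ _)
    _ ≤ _ := lintegral_enorm_mul_enorm_le hf.continuous.aestronglyMeasurable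
        hf2.continuous.aestronglyMeasurable

lemma eLpNorm_dirDeriv_sq_le_hessian {f : E → F} (hf : ContDiff ℝ (⊤ : ℕ∞) f)
    (hc : HasCompactSupport f) {v : E} (hv : ‖v‖ ≤ 1) :
    eLpNorm (dirDeriv v f) 2 μ ^ 2 ≤
      eLpNorm f 2 μ * eLpNorm (fun x => ‖iteratedFDeriv ℝ 2 f x‖) 2 μ :=
  (eLpNorm_dirDeriv_sq_le hf hc v).trans (by gcongr; exact eLpNorm_dirDeriv_dirDeriv_le hf hv hv)

end Interpolation

section Square

variable {E : Type*} [NormedAddCommGroup E] [NormedSpace ℝ E]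

lemma dirDeriv_sq {f : E → ℂ} (hf : ContDiff ℝ (⊤ : ℕ∞) f) (v : E) :
    dirDeriv v (fun x => f x ^ 2) = fun x => 2 * (f x * dirDeriv v f x) := by
  ext x
  have h := (hf.differentiable (by simp)).differentiableAt (x := x)
  simp only [dirDeriv, sq]
  rw [fderiv_fun_mul h h]
  simp
  ring

lemma dirDeriv_dirDeriv_sq {f : E → ℂ} (hf : ContDiff ℝ (⊤ : ℕ∞) f) (v w : E) :
    dirDeriv w (dirDeriv v (fun x => f x ^ 2)) =
      fun x => 2 * (dirDeriv w f x * dirDeriv v f x + f x * dirDeriv w (dirDeriv v f) x) := by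
  rw [dirDeriv_sq hf]
  ext x
  have h := (hf.differentiable (by simp)).differentiableAt (x := x)
  have h1 := ((hf.dirDeriv v).differentiable (by simp)).differentiableAt (x := x)
  have : fderiv ℝ (fun x => 2 * (f x * dirDeriv v f x)) x w =
      2 * (fderiv ℝ f x w * dirDeriv v f x + f x * fderiv ℝ (dirDeriv v f) x w) := by
    rw [fderiv_const_mul (h.fun_mul h1), fderiv_fun_mul h h1]
    simp
    ring
  exact this

end Square

lemma enorm_pow_four_le_of_dim_one {f : EuclideanSpace ℝ (Fin 1) → ℂ}
    (hf : ContDiff ℝ (⊤ : ℕ∞) f) (hc : HasCompactSupport f) (x : EuclideanSpace ℝ (Fin 1)) :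
    ‖f x‖ₑ ^ 4 ≤ 16 * (eLpNorm f 2 volume ^ 3 *
      eLpNorm (fun x => ‖iteratedFDeriv ℝ 2 f x‖) 2 volume) := by
  set e : EuclideanSpace ℝ (Fin 1) := EuclideanSpace.single 0 1
  set N := eLpNorm f 2 volume
  set H := eLpNorm (fun x => ‖iteratedFDeriv ℝ 2 f x‖) 2 volume
  have he : ‖e‖ = 1 := by simp [e]
  have he0 : e ≠ 0 := norm_ne_zero_iff.1 (by simp [he])
  have hmp : MeasurePreserving (fun t : ℝ => x + t • e) volume volume := by
    have h := (measurePreserving_add_left volume x).comp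
      ((PiLp.volume_preserving_toLp (Fin 1)).comp (volume_preserving_funUnique (Fin 1) ℝ).symm)
    convert h using 1
    ext t i
    fin_cases i
    simp [e]
  have hf1 := hf.dirDeriv e
  have hc2 : HasCompactSupport (fun x => f x ^ 2) :=
    hc.mono fun x hx h0 => hx (by simp [h0])
  have hsq : ‖f x‖ₑ ^ 2 ≤ 2 * (N * eLpNorm (dirDeriv e f) 2 volume) := by
    calc ‖f x‖ₑ ^ 2 = ‖f x ^ 2‖ₑ := (enorm_pow _ _).symm
      _ ≤ ∫⁻ t : ℝ, ‖dirDeriv e (fun x => f x ^ 2) (x + t • e)‖ₑ :=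
        enorm_le_lintegral_dirDeriv (hf.pow 2) hc2 x he0
      _ = ∫⁻ y, ‖dirDeriv e (fun x => f x ^ 2) y‖ₑ :=
        hmp.lintegral_comp ((hf.pow 2).dirDeriv e).continuous.enorm.measurable
      _ = 2 * ∫⁻ y, ‖f y‖ₑ * ‖dirDeriv e f y‖ₑ := by
        rw [dirDeriv_sq hf, ← lintegral_const_mul' _ _ (by simp)]
        simp [enorm_mul, ← ofReal_norm (2 : ℂ)]
      _ ≤ _ := by
        gcongr
        exact lintegral_enorm_mul_enorm_le hf.continuous.aestronglyMeasurable
          hf1.continuous.aestronglyMeasurable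
  calc ‖f x‖ₑ ^ 4 = (‖f x‖ₑ ^ 2) ^ 2 := by ring
    _ ≤ (2 * (N * eLpNorm (dirDeriv e f) 2 volume)) ^ 2 := by gcongr
    _ = 4 * (N ^ 2 * eLpNorm (dirDeriv e f) 2 volume ^ 2) := by ring
    _ ≤ 16 * (N ^ 2 * (N * H)) := by
      gcongr
      · norm_num
      · exact eLpNorm_dirDeriv_sq_le_hessian hf hc he.le
    _ = _ := by ring

lemma enorm_pow_four_le_of_dim_two {f : EuclideanSpace ℝ (Fin 2) → ℂ}
    (hf : ContDiff ℝ (⊤ : ℕ∞) f) (hc : HasCompactSupport f) (x : EuclideanSpace ℝ (Fin 2)) :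
    ‖f x‖ₑ ^ 4 ≤ 16 * (eLpNorm f 2 volume ^ 2 *
      eLpNorm (fun x => ‖iteratedFDeriv ℝ 2 f x‖) 2 volume ^ 2) := by
  set v : EuclideanSpace ℝ (Fin 2) := EuclideanSpace.single 0 1
  set w : EuclideanSpace ℝ (Fin 2) := EuclideanSpace.single 1 1
  set N := eLpNorm f 2 volume
  set H := eLpNorm (fun x => ‖iteratedFDeriv ℝ 2 f x‖) 2 volume
  have hv : ‖v‖ = 1 := by simp [v]
  have hw : ‖w‖ = 1 := by simp [w]
  have hv0 : v ≠ 0 := norm_ne_zero_iff.1 (by simp [hv])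
  have hw0 : w ≠ 0 := norm_ne_zero_iff.1 (by simp [hw])
  have hmp : MeasurePreserving (fun p : ℝ × ℝ => x + p.1 • v + p.2 • w) volume volume := by
    have h := (measurePreserving_add_left volume x).comp
      ((PiLp.volume_preserving_toLp (Fin 2)).comp (volume_preserving_finTwoArrow ℝ).symm)
    convert h using 1
    ext t i
    fin_cases i <;> simp [v, w]
  have hf2 := hf.pow 2
  have hc2 : HasCompactSupport (fun x => f x ^ 2) :=
    hc.mono fun x hx h0 => hx (by simp [h0])
  have hcont : Continuous fun y => ‖dirDeriv w (dirDeriv v fun x => f x ^ 2) y‖ₑ :=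
    ((hf2.dirDeriv v).dirDeriv w).continuous.enorm
  have hfirst : eLpNorm (dirDeriv w f) 2 volume * eLpNorm (dirDeriv v f) 2 volume ≤ N * H := by
    rw [← ENNReal.pow_le_pow_left_iff two_ne_zero, mul_pow, sq (N * H)]
    exact mul_le_mul' (eLpNorm_dirDeriv_sq_le_hessian hf hc hw.le)
      (eLpNorm_dirDeriv_sq_le_hessian hf hc hv.le)
  have hsq : ‖f x‖ₑ ^ 2 ≤ 4 * (N * H) := by
    calc ‖f x‖ₑ ^ 2 = ‖f x ^ 2‖ₑ := (enorm_pow _ _).symm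
      _ ≤ ∫⁻ s : ℝ, ‖dirDeriv v (fun x => f x ^ 2) (x + s • v)‖ₑ :=
        enorm_le_lintegral_dirDeriv hf2 hc2 x hv0
      _ ≤ ∫⁻ s : ℝ, ∫⁻ t : ℝ,
          ‖dirDeriv w (dirDeriv v fun x => f x ^ 2) (x + s • v + t • w)‖ₑ :=
        lintegral_mono fun s =>
          enorm_le_lintegral_dirDeriv (hf2.dirDeriv v) (hc2.dirDeriv v) _ hw0
      _ = ∫⁻ p : ℝ × ℝ,
          ‖dirDeriv w (dirDeriv v fun x => f x ^ 2) (x + p.1 • v + p.2 • w)‖ₑ :=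
        (lintegral_prod _ (hcont.measurable.comp hmp.measurable).aemeasurable).symm
      _ = ∫⁻ y, ‖dirDeriv w (dirDeriv v fun x => f x ^ 2) y‖ₑ :=
        hmp.lintegral_comp hcont.measurable
      _ ≤ ∫⁻ y, 2 * (‖dirDeriv w f y‖ₑ * ‖dirDeriv v f y‖ₑ +
          ‖f y‖ₑ * ‖dirDeriv w (dirDeriv v f) y‖ₑ) := by
        rw [dirDeriv_dirDeriv_sq hf]
        refine lintegral_mono fun y => ?_
        rw [← enorm_mul, ← enorm_mul, enorm_mul 2, show ‖(2 : ℂ)‖ₑ = 2 by simp [← ofReal_norm]]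
        gcongr
        exact enorm_add_le _ _
      _ = 2 * (∫⁻ y, ‖dirDeriv w f y‖ₑ * ‖dirDeriv v f y‖ₑ) +
          2 * ∫⁻ y, ‖f y‖ₑ * ‖dirDeriv w (dirDeriv v f) y‖ₑ := by
        rw [lintegral_const_mul' _ _ (by simp), lintegral_add_left, mul_add]
        exact (hf.dirDeriv w).continuous.enorm.measurable.mul
          (hf.dirDeriv v).continuous.enorm.measurable
      _ ≤ 2 * (N * H) + 2 * (N * H) := by
        gcongr
        · exact (lintegral_enorm_mul_enorm_le (hf.dirDeriv w).continuous.aestronglyMeasurable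
            (hf.dirDeriv v).continuous.aestronglyMeasurable).trans hfirst
        · refine (lintegral_enorm_mul_enorm_le hf.continuous.aestronglyMeasurable
            ((hf.dirDeriv v).dirDeriv w).continuous.aestronglyMeasurable).trans ?_
          gcongr
          exact eLpNorm_dirDeriv_dirDeriv_le hf hv.le hw.le
      _ = 4 * (N * H) := by ring
  calc ‖f x‖ₑ ^ 4 = (‖f x‖ₑ ^ 2) ^ 2 := by ring
    _ ≤ (4 * (N * H)) ^ 2 := by gcongr
    _ = _ := by ring

/-- Agmon's inequality in dimensions one and two. -/
lemma enorm_pow_four_le {d : ℕ} (hd : d = 1 ∨ d = 2) {f : EuclideanSpace ℝ (Fin d) → ℂ}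
    (hf : ContDiff ℝ (⊤ : ℕ∞) f) (hc : HasCompactSupport f) (x : EuclideanSpace ℝ (Fin d)) :
    ‖f x‖ₑ ^ 4 ≤ 16 * (eLpNorm f 2 volume ^ (4 - d) *
      eLpNorm (fun x => ‖iteratedFDeriv ℝ 2 f x‖) 2 volume ^ d) := by
  obtain rfl | rfl := hd
  · simpa using enorm_pow_four_le_of_dim_one hf hc x
  · simpa using enorm_pow_four_le_of_dim_two hf hc x

lemma eLpNorm_two_sq_le_of_bound {X F : Type*} [MeasurableSpace X] {μ : Measure X}
    [NormedAddCommGroup F] {f : X → F} {M : ENNReal} (hM : M ≠ ⊤) (hb : ∀ x, ‖f x‖ₑ ≤ M)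
    {α : ℝ} (hα₀ : 0 < α) (hα₁ : α ≤ 1) :
    eLpNorm f 2 μ ^ 2 ≤ M ^ α * eLpNorm f (ENNReal.ofReal (2 - α)) μ ^ (2 - α) := by
  have hpos : 0 < 2 - α := by linarith
  rw [eLpNorm_two_sq, eLpNorm_eq_lintegral_rpow_enorm_toReal (by simpa using hpos) (by simp),
    ENNReal.toReal_ofReal hpos.le, one_div, ENNReal.rpow_inv_rpow hpos.ne',
    ← lintegral_const_mul' _ _ (ENNReal.rpow_ne_top_of_nonneg hα₀.le hM)]
  refine lintegral_mono fun x => ?_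
  calc ‖f x‖ₑ ^ 2 = ‖f x‖ₑ ^ α * ‖f x‖ₑ ^ (2 - α) := by
        rw [← ENNReal.rpow_add_of_nonneg _ _ hα₀.le hpos.le, ← ENNReal.rpow_natCast]
        norm_num
    _ ≤ _ := by gcongr; exact hb x

theorem nash_inequality_second_order (d : ℕ) (hd : d = 1 ∨ d = 2) (α : ℝ)
    (hα₀ : 0 < α) (hα₁ : α ≤ 1) :
    ∃ C > 0, ∀ f : EuclideanSpace ℝ (Fin d) → ℂ,
      ContDiff ℝ (⊤ : ℕ∞) f → HasCompactSupport f →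
      (eLpNorm f 2 volume).toReal ^ (α * d + 8 - 4 * α) ≤
        C * (eLpNorm f (ENNReal.ofReal (2 - α)) volume).toReal ^ (4 * (2 - α)) *
          (eLpNorm (fun x => ‖iteratedFDeriv ℝ 2 f x‖) 2 volume).toReal ^ (α * d) := by
  refine ⟨16 ^ α, by positivity, fun f hf hc => ?_⟩
  have hNtop : eLpNorm f 2 volume ≠ ⊤ :=
    (hf.continuous.memLp_of_hasCompactSupport hc).eLpNorm_ne_top
  have hPtop : eLpNorm f (ENNReal.ofReal (2 - α)) volume ≠ ⊤ :=
    (hf.continuous.memLp_of_hasCompactSupport hc).eLpNorm_ne_top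
  have hHtop : eLpNorm (fun x => ‖iteratedFDeriv ℝ 2 f x‖) 2 volume ≠ ⊤ :=
    ((hf.continuous_iteratedFDeriv (m := 2)
      (WithTop.coe_le_coe.2 le_top)).norm.memLp_of_hasCompactSupport
      (hc.iteratedFDeriv 2).norm).eLpNorm_ne_top
  have hsup := enorm_pow_four_le hd hf hc
  set N := eLpNorm f 2 volume
  set P := eLpNorm f (ENNReal.ofReal (2 - α)) volume
  set H := eLpNorm (fun x => ‖iteratedFDeriv ℝ 2 f x‖) 2 volume
  set K := 16 * (N ^ (4 - d) * H ^ d)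
  have hKtop : K ≠ ⊤ := by finiteness
  have hb (x) : ‖f x‖ₑ ≤ K ^ (4⁻¹ : ℝ) := by
    rw [ENNReal.le_rpow_inv_iff (by norm_num)]
    exact_mod_cast hsup x
  have hmain := eLpNorm_two_sq_le_of_bound (μ := volume)
    (ENNReal.rpow_ne_top_of_nonneg (by norm_num) hKtop) hb hα₀ hα₁
  have hreal : N.toReal ^ 2 ≤ (K.toReal ^ (4⁻¹ : ℝ)) ^ α * P.toReal ^ (2 - α) := by
    have h := ENNReal.toReal_mono (by finiteness [show 0 ≤ 2 - α by linarith]) hmain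
    simpa [ENNReal.toReal_mul, ENNReal.toReal_rpow, ENNReal.toReal_pow] using h
  have hK : K.toReal = 16 * (N.toReal ^ (4 - d) * H.toReal ^ d) := by
    simp [K, ENNReal.toReal_mul]
  have hn : 0 ≤ N.toReal := ENNReal.toReal_nonneg
  have hp : 0 ≤ P.toReal := ENNReal.toReal_nonneg
  have hh : 0 ≤ H.toReal := ENNReal.toReal_nonneg
  generalize N.toReal = n at *
  generalize P.toReal = p at *
  generalize H.toReal = h at *
  have hd2 : d ≤ 2 := by omega
  have hd2' : (d : ℝ) ≤ 2 := by exact_mod_cast hd2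
  have hfour : n ^ (8 : ℝ) ≤
      16 ^ α * n ^ (α * (4 - d)) * h ^ (α * d) * p ^ (4 * (2 - α)) := by
    calc n ^ (8 : ℝ) = (n ^ 2) ^ 4 := by rw [← pow_mul]; exact_mod_cast rfl
      _ ≤ ((K.toReal ^ (4⁻¹ : ℝ)) ^ α * p ^ (2 - α)) ^ 4 := by gcongr
      _ = K.toReal ^ α * p ^ (4 * (2 - α)) := by
        rw [mul_pow, ← Real.rpow_mul (by positivity), ← Real.rpow_mul_natCast (by positivity),
          ← Real.rpow_mul_natCast hp]
        congr 2 <;> push_cast <;> ring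
      _ = _ := by
        rw [hK, Real.mul_rpow (by positivity) (by positivity),
          Real.mul_rpow (by positivity) (by positivity), ← Real.rpow_natCast_mul hn,
          ← Real.rpow_natCast_mul hh, Nat.cast_sub (by omega)]
        push_cast
        rw [mul_comm (4 - (d : ℝ)), mul_comm (d : ℝ)]
        ring
  rcases hn.eq_or_lt with rfl | hn
  · rw [Real.zero_rpow (by nlinarith [mul_nonneg hα₀.le (Nat.cast_nonneg (α := ℝ) d)])]
    positivity
  · have hsplit : n ^ (8 : ℝ) = n ^ (α * (4 - d)) * n ^ (α * d + 8 - 4 * α) := by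
      rw [← Real.rpow_add hn]
      ring_nf
    refine le_of_mul_le_mul_left ?_ (Real.rpow_pos_of_pos hn (α * (4 - d)))
    rw [← hsplit]
    exact hfour.trans_eq (by ring)
end

section
/- Let T > 0, C > 0, and let ε : [0,T] → ℝ be continuous on [0,T] and differentiable on (0,T), with ε(t) ≥ 0 for all t ∈ [0,T] and ε(0) = 0. Assume that for every real number p ≥ 2 and every t ∈ (0,T), ε'(t) ≤ C p ε(t)^{1 − 3/(2p)}. Then ε(t) = 0 for all t ∈ [0,T]. -/
open Set Filter Topology

/-- If `f` vanishes at `s`, is positive on `(s, t)` and satisfies `f' ≤ M f ^ (1 - a)` on `(s, t)`,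
then `f t ^ a ≤ a * M * (t - s)`. -/
theorem rpow_le_of_deriv_le_rpow_one_sub {f : ℝ → ℝ} {s t a M : ℝ} (hst : s ≤ t) (ha : 0 < a)
    (hcont : ContinuousOn f (Icc s t)) (hdiff : ∀ x ∈ Ioo s t, DifferentiableAt ℝ f x)
    (hs : f s = 0) (hpos : ∀ x ∈ Ioo s t, 0 < f x)
    (hderiv : ∀ x ∈ Ioo s t, deriv f x ≤ M * f x ^ (1 - a)) :
    f t ^ a ≤ a * M * (t - s) := by
  have hd : ∀ x ∈ Ioo s t, HasDerivAt (fun y => f y ^ a) (deriv f x * a * f x ^ (a - 1)) x :=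
    fun x hx => (hdiff x hx).hasDerivAt.rpow_const (Or.inl (hpos x hx).ne')
  have key := (convex_Icc s t).image_sub_le_mul_sub_of_deriv_le (f := fun y => f y ^ a)
    (C := a * M) (hcont.rpow_const fun _ _ => Or.inr ha.le)
    (by
      rw [interior_Icc]
      exact fun x hx => (hd x hx).differentiableAt.differentiableWithinAt)
    (by
      rw [interior_Icc]
      intro x hx
      rw [(hd x hx).deriv]
      have hx0 := hpos x hx
      calc deriv f x * a * f x ^ (a - 1)
          ≤ M * f x ^ (1 - a) * a * f x ^ (a - 1) := by
            gcongr
            exact hderiv x hx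
        _ = a * M * (f x ^ (1 - a) * f x ^ (a - 1)) := by ring
        _ = a * M := by rw [← Real.rpow_add hx0]; simp)
    s (left_mem_Icc.2 hst) t (right_mem_Icc.2 hst) hst
  simpa [hs, Real.zero_rpow ha.ne'] using key

/-- A continuous function vanishing at `a` but not at `b` has a last zero in `[a, b]`. -/
theorem exists_last_zero {f : ℝ → ℝ} {a b : ℝ} (hab : a ≤ b) (hcont : ContinuousOn f (Icc a b))
    (ha : f a = 0) (hb : f b ≠ 0) : ∃ s ∈ Ico a b, f s = 0 ∧ ∀ x ∈ Ioc s b, f x ≠ 0 := by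
  have hclosed : IsClosed (Icc a b ∩ f ⁻¹' {0}) :=
    hcont.preimage_isClosed_of_isClosed isClosed_Icc isClosed_singleton
  obtain ⟨s, ⟨hs, hs0⟩, hmax⟩ :=
    (isCompact_Icc.of_isClosed_subset hclosed inter_subset_left).exists_isGreatest
      ⟨a, left_mem_Icc.2 hab, ha⟩
  refine ⟨s, ⟨hs.1, hs.2.lt_of_ne ?_⟩, hs0, fun x hx hx0 => ?_⟩
  · rintro rfl
    exact hb hs0
  · exact hx.1.not_ge (hmax ⟨⟨hs.1.trans hx.1.le, hx.2⟩, hx0⟩)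


/-- Yudovich-type uniqueness lemma: if `ε ≥ 0` on `[0,T]`, `ε(0) = 0`, and for
every `p ≥ 2` one has `ε'(t) ≤ C p ε(t)^{1 − 3/(2p)}` on `(0,T)`, then `ε ≡ 0`
on `[0,T]`. -/
theorem yudovich_uniqueness_lemma (T C : ℝ) (hT : 0 < T) (hC : 0 < C)
    (ε : ℝ → ℝ)
    (hcont : ContinuousOn ε (Set.Icc 0 T))
    (hdiff : ∀ t ∈ Set.Ioo 0 T, DifferentiableAt ℝ ε t)
    (hnonneg : ∀ t ∈ Set.Icc 0 T, 0 ≤ ε t)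
    (hzero : ε 0 = 0)
    (hineq : ∀ p : ℝ, 2 ≤ p → ∀ t ∈ Set.Ioo 0 T,
      deriv ε t ≤ C * p * ε t ^ (1 - 3 / (2 * p))) :
    ∀ t ∈ Set.Icc 0 T, ε t = 0 := by
  intro b hb
  by_contra hne
  obtain ⟨s, hs, hs0, hs_ne⟩ :=
    exists_last_zero hb.1 (hcont.mono (Icc_subset_Icc_right hb.2)) hzero hne
  obtain ⟨t, hst, ht⟩ : ∃ t, s < t ∧ t < min b (s + 1 / (3 * C)) :=
    exists_between (lt_min hs.2 (lt_add_of_pos_right s (by positivity)))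
  obtain ⟨htb, hts⟩ := lt_min_iff.1 ht
  have hpos : ∀ x ∈ Ioc s t, 0 < ε x := fun x hx =>
    (hnonneg x ⟨hs.1.trans hx.1.le, hx.2.trans (htb.le.trans hb.2)⟩).lt_of_ne'
      (hs_ne x ⟨hx.1, hx.2.trans htb.le⟩)
  have hsub : Ioo s t ⊆ Ioo 0 T := Ioo_subset_Ioo hs.1 (htb.le.trans hb.2)
  have hbound : ∀ p : ℝ, 2 ≤ p → ε t ^ (3 / (2 * p)) ≤ 1 / 2 := by
    intro p hp
    have hp0 : 0 < p := by linarith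
    calc ε t ^ (3 / (2 * p)) ≤ 3 / (2 * p) * (C * p) * (t - s) :=
          rpow_le_of_deriv_le_rpow_one_sub hst.le (by positivity)
            (hcont.mono (Icc_subset_Icc hs.1 (htb.le.trans hb.2)))
            (fun x hx => hdiff x (hsub hx)) hs0 (fun x hx => hpos x (Ioo_subset_Ioc_self hx))
            fun x hx => hineq p hp x (hsub hx)
      _ ≤ 3 / (2 * p) * (C * p) * (1 / (3 * C)) := by gcongr; linarith
      _ = 1 / 2 := by field_simp
  have hexp : Tendsto (fun p : ℝ => 3 / (2 * p)) atTop (𝓝 0) :=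
    tendsto_const_nhds.div_atTop (tendsto_id.const_mul_atTop two_pos)
  have hlim : Tendsto (fun p : ℝ => ε t ^ (3 / (2 * p))) atTop (𝓝 1) := by
    simpa using tendsto_const_nhds.rpow hexp (Or.inl (hpos t ⟨hst, le_rfl⟩).ne')
  have := le_of_tendsto hlim ((eventually_ge_atTop 2).mono hbound)
  norm_num at this
end

section
/- Let θ be a real number with 0 < θ < 1, let g : [0,∞) → ℝ be continuous with g(t) ≥ 0 for all t, and let y : [0,∞) → ℝ be differentiable with y(t) ≥ 0 and y'(t) ≤ −g(t) · y(t)^θ for all t ≥ 0. If y(0)^{1−θ} < (1−θ) · ∫₀^∞ g(τ) dτ, then there exists T ≥ 0 such that y(t) = 0 for all t ≥ T. -/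
open MeasureTheory

/-- A nonnegative function that is antitone on `[0, ∞)` stays zero once it vanishes. -/
theorem eq_zero_of_antitoneOn_of_nonneg {y : ℝ → ℝ} (hy : AntitoneOn y (Set.Ici 0))
    (hnonneg : ∀ t, 0 ≤ t → 0 ≤ y t) {T : ℝ} (hT : 0 ≤ T) (hyT : y T = 0) :
    ∀ t ≥ T, y t = 0 := fun t ht =>
  le_antisymm (hyT ▸ hy hT (hT.trans ht) ht) (hnonneg t (hT.trans ht))

/-- As long as a solution of `y' ≤ -g y ^ θ` stays positive, `(1 - θ) ∫ g` is bounded by the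
initial value of `y ^ (1 - θ)`. -/
theorem mul_integral_le_rpow_of_deriv_le {θ : ℝ} (hθ₁ : θ < 1) {g y : ℝ → ℝ} (hg : Continuous g)
    (hdiff : ∀ t, 0 ≤ t → DifferentiableAt ℝ y t) (hpos : ∀ t, 0 ≤ t → 0 < y t)
    (hineq : ∀ t, 0 ≤ t → deriv y t ≤ -(g t) * y t ^ θ) {t : ℝ} (ht : 0 ≤ t) :
    (1 - θ) * ∫ τ in (0 : ℝ)..t, g τ ≤ y 0 ^ (1 - θ) := by
  have hderiv : ∀ s, 0 ≤ s → HasDerivAt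
      (fun s => y s ^ (1 - θ) + (1 - θ) * ∫ τ in (0 : ℝ)..s, g τ)
      (deriv y s * (1 - θ) * y s ^ (1 - θ - 1) + (1 - θ) * g s) s := fun s hs =>
    ((hdiff s hs).hasDerivAt.rpow_const (Or.inl (hpos s hs).ne')).add
      ((hg.integral_hasStrictDerivAt 0 s).hasDerivAt.const_mul (1 - θ))
  have hanti : AntitoneOn (fun s => y s ^ (1 - θ) + (1 - θ) * ∫ τ in (0 : ℝ)..s, g τ)
      (Set.Ici 0) := by
    refine antitoneOn_of_deriv_nonpos (convex_Ici 0)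
      (fun s hs => (hderiv s hs).continuousAt.continuousWithinAt)
      (fun s hs => (hderiv s (interior_subset hs)).differentiableAt.differentiableWithinAt)
      fun s hs => ?_
    have hs : 0 ≤ s := interior_subset hs
    rw [(hderiv s hs).deriv]
    have hcancel : y s ^ θ * y s ^ (1 - θ - 1) = 1 := by
      rw [← Real.rpow_add (hpos s hs), show θ + (1 - θ - 1) = 0 by ring, Real.rpow_zero]
    have hmul := mul_le_mul_of_nonneg_right (hineq s hs)
      (mul_nonneg (sub_nonneg.2 hθ₁.le) (Real.rpow_nonneg (hpos s hs).le (1 - θ - 1)))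
    linear_combination hmul - g s * (1 - θ) * hcancel
  have hle := hanti Set.self_mem_Ici ht ht
  simp only [intervalIntegral.integral_same, mul_zero, add_zero] at hle
  linarith [Real.rpow_nonneg (hpos t ht).le (1 - θ)]

/-- Uniform bounds on `∫ g` over `(0, n]` bound the integral over `(0, ∞)`. -/
theorem mul_lintegral_Ioi_le_of_intervalIntegral_le {g : ℝ → ℝ} (hg : Continuous g)
    (hg0 : ∀ t, 0 ≤ g t) {c C : ℝ} (hc : 0 ≤ c)
    (h : ∀ n : ℕ, c * ∫ τ in (0 : ℝ)..n, g τ ≤ C) :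
    ENNReal.ofReal c * ∫⁻ τ in Set.Ioi (0 : ℝ), ENNReal.ofReal (g τ) ≤ ENNReal.ofReal C := by
  have hunion : Set.Ioi (0 : ℝ) = ⋃ n : ℕ, Set.Ioc (0 : ℝ) n :=
    (Set.iUnion_Ioc_eq_Ioi_self_iff.2 fun t _ => exists_nat_ge t).symm
  have hdir : Directed (· ⊆ ·) fun n : ℕ => Set.Ioc (0 : ℝ) n :=
    Monotone.directed_le fun m n hmn => Set.Ioc_subset_Ioc_right (Nat.cast_le.2 hmn)
  rw [hunion, setLIntegral_iUnion_of_directed _ hdir, ENNReal.mul_iSup]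
  refine iSup_le fun n => ?_
  rw [← ofReal_integral_eq_lintegral_ofReal
      (hg.integrableOn_Ioc) (Filter.Eventually.of_forall hg0),
    ← intervalIntegral.integral_of_le n.cast_nonneg, ← ENNReal.ofReal_mul hc]
  exact ENNReal.ofReal_le_ofReal (h n)

/-- Finite time extinction for the time-dependent differential inequality
`y' ≤ −g(t) y^θ`, `0 < θ < 1`, with `g ≥ 0` continuous: if
`y(0)^{1−θ} < (1−θ) ∫₀^∞ g(τ) dτ` (the integral possibly infinite), then `y`
vanishes identically after some finite time `T`. -/
theorem finite_time_extinction_time_dependent (θ : ℝ) (hθ₀ : 0 < θ) (hθ₁ : θ < 1)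
    (g : ℝ → ℝ) (hgcont : ContinuousOn g (Set.Ici 0)) (hgnonneg : ∀ t, 0 ≤ t → 0 ≤ g t)
    (y : ℝ → ℝ)
    (hdiff : ∀ t, 0 ≤ t → DifferentiableAt ℝ y t)
    (hnonneg : ∀ t, 0 ≤ t → 0 ≤ y t)
    (hineq : ∀ t, 0 ≤ t → deriv y t ≤ -(g t) * y t ^ θ)
    (hsmall : ENNReal.ofReal (y 0 ^ (1 - θ)) <
      ENNReal.ofReal (1 - θ) * ∫⁻ τ in Set.Ioi (0 : ℝ), ENNReal.ofReal (g τ)) :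
    ∃ T ≥ 0, ∀ t ≥ T, y t = 0 := by
  have hanti : AntitoneOn y (Set.Ici 0) := by
    refine antitoneOn_of_deriv_nonpos (convex_Ici 0)
      (fun s hs => (hdiff s hs).continuousAt.continuousWithinAt)
      (fun s hs => (hdiff s (interior_subset hs)).differentiableWithinAt) fun s hs => ?_
    have hs : 0 ≤ s := interior_subset hs
    nlinarith [hineq s hs, mul_nonneg (hgnonneg s hs) (Real.rpow_nonneg (hnonneg s hs) θ)]
  by_cases hzero : ∃ T, 0 ≤ T ∧ y T = 0
  · obtain ⟨T, hT, hyT⟩ := hzero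
    exact ⟨T, hT, eq_zero_of_antitoneOn_of_nonneg hanti hnonneg hT hyT⟩
  have hpos : ∀ t, 0 ≤ t → 0 < y t := fun t ht =>
    (hnonneg t ht).lt_of_ne fun h => hzero ⟨t, ht, h.symm⟩
  have hext : Continuous fun t => g (max t 0) :=
    hgcont.comp_continuous (by fun_prop) fun t => le_max_right t 0
  have hbound := mul_lintegral_Ioi_le_of_intervalIntegral_le hext
    (fun t => hgnonneg _ (le_max_right t 0)) (sub_nonneg.2 hθ₁.le) fun n =>
      mul_integral_le_rpow_of_deriv_le hθ₁ hext hdiff hpos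
        (fun t ht => by simpa only [max_eq_left ht] using hineq t ht) n.cast_nonneg
  have hcongr : ∫⁻ τ in Set.Ioi (0 : ℝ), ENNReal.ofReal (g (max τ 0)) =
      ∫⁻ τ in Set.Ioi (0 : ℝ), ENNReal.ofReal (g τ) :=
    setLIntegral_congr_fun measurableSet_Ioi fun t ht => by
      simp only [max_eq_left (Set.mem_Ioi.1 ht).le]
  rw [hcongr] at hbound
  exact absurd hsmall hbound.not_gt
end
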